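/- Let φ be a (2,3)-CNF formula with n variables (each clause exactly two literals, each variable in at least 2 and at most 3 clauses), and let T_φ be the Tournament Value Maximization instance obtained from φ by Construction 2. If φ admits a truth assignment satisfying at least k clauses, then T_φ admits a tournament seeding whose tournament value is at least k + n. -/

import Mathlib

/-- Players are natural numbers; player `i` beats player `j` iff `i > j`.
Hence the winner of a (sub)tournament is its strongest player, i.e. the maximum
of the list of participating players. -/
def winner (l : List ℕ) : ℕ := l.foldr max 0

/-- The tournament value of the seeding given by the list `l` of players in
seed-position order (`l.length = 2 ^ m`), with respect to the game-value
function `v`: the value of a tournament on a single player is `0`; otherwise it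
is the value of the subtournament of the first half of the seed positions, plus
the value of the subtournament of the second half, plus `v i₁ i₂ m` where
`i₁, i₂` are the winners of the two halves playing each other in the final
round `m`. -/
def tourValue (v : ℕ → ℕ → ℕ → ℤ) : ℕ → List ℕ → ℤ
  | 0, _ => 0
  | m + 1, l =>
      tourValue v m (l.take (2 ^ m)) + tourValue v m (l.drop (2 ^ m)) +
        v (winner (l.take (2 ^ m))) (winner (l.drop (2 ^ m))) (m + 1)

/-- `l` is a tournament seeding for the player set `N` iff `l` lists the
elements of `N`, each exactly once, in seed-position order. -/
def IsSeeding (N : Finset ℕ) (l : List ℕ) : Prop := l.Nodup ∧ l.toFinset = N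

/-- The number of games won by player `i` in the tournament with `m` rounds on
the seeding `l`: in each (sub)tournament, the final game is won by the stronger
of the winners of the two halves. -/
def winCount (i : ℕ) : ℕ → List ℕ → ℕ
  | 0, _ => 0
  | m + 1, l =>
      winCount i m (l.take (2 ^ m)) + winCount i m (l.drop (2 ^ m)) +
        if i = max (winner (l.take (2 ^ m))) (winner (l.drop (2 ^ m))) then 1 else 0

/-- A clause with exactly two literals; a literal is a pair
(variable, polarity). -/
abbrev Clause2 := (ℕ × Bool) × (ℕ × Bool)

/-- The assignment `α` satisfies the clause `c` if it makes at least one of its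
two literals true. -/
def clauseSat (α : ℕ → Bool) (c : Clause2) : Bool :=
  (α c.1.1 == c.1.2) || (α c.2.1 == c.2.2)

/-- The number of clauses of `cs` satisfied by the assignment `α`. -/
def satCount (α : ℕ → Bool) (cs : List Clause2) : ℕ := cs.countP (clauseSat α)

/-- The list of all literal occurrences of the formula, in order. -/
def lits (cs : List Clause2) : List (ℕ × Bool) :=
  cs.foldr (fun c acc => c.1 :: c.2 :: acc) []

/-- `cs` is a (2,3)-CNF formula on the variables `1, …, n`: each clause has two
literals on two distinct variables from `{1, …, n}`, and each variable occurs
(equivalently, appears in) at least `2` and at most `3` clauses. -/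
def Good23 (n : ℕ) (cs : List Clause2) : Prop :=
  (∀ c ∈ cs, 1 ≤ c.1.1 ∧ c.1.1 ≤ n ∧ 1 ≤ c.2.1 ∧ c.2.1 ≤ n ∧ c.1.1 ≠ c.2.1) ∧
  (∀ x : ℕ, 1 ≤ x → x ≤ n →
      2 ≤ (lits cs).countP (fun p => p.1 == x) ∧
        (lits cs).countP (fun p => p.1 == x) ≤ 3)

/-- The total number of players `2 ^ n'`, where `n'` is the smallest integer
with `16 * n ≤ 2 ^ n'`.  The player set is `{0, 1, …, numP n - 1}` and the
`k`-th strongest player is the number `numP n - k`. -/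
def numP (n : ℕ) : ℕ := 2 ^ Nat.clog 2 (16 * n)

/-- The special player `d̂_i` (`i ∈ {1, …, n}`), of strength rank `3*i - 2`. -/
def dHat (n i : ℕ) : ℕ := numP n - (3 * i - 2)

/-- The special player `d_i`, of strength rank `3*i - 1`. -/
def dMid (n i : ℕ) : ℕ := numP n - (3 * i - 1)

/-- The special player `d̃_i`, of strength rank `3*i`. -/
def dTil (n i : ℕ) : ℕ := numP n - (3 * i)

/-- The variable player `x_i` (`i ∈ {1, …, n}`), of strength rank `3*n + 3*i - 2`. -/
def xPl (n i : ℕ) : ℕ := numP n - (3 * n + 3 * i - 2)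

/-- The variable player `x_i^T`, of strength rank `3*n + 3*i - 1`. -/
def xTPl (n i : ℕ) : ℕ := numP n - (3 * n + 3 * i - 1)

/-- The variable player `x_i^F`, of strength rank `3*n + 3*i`. -/
def xFPl (n i : ℕ) : ℕ := numP n - (3 * n + 3 * i)

/-- The clause player `c_j` (`j ∈ {1, …, m}`), of strength rank `6*n + j`;
the remaining numbers are the dummy players `f_1, …, f_{10n+p-m}`. -/
def cPl (n j : ℕ) : ℕ := numP n - (6 * n + j)

/-- The variable player corresponding to a literal: `x_i^T` for a positive and
`x_i^F` for a negative occurrence of `x_i`. -/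
def litPl (n : ℕ) (p : ℕ × Bool) : ℕ := if p.2 then xTPl n p.1 else xFPl n p.1

/-- The games of value `1` of Construction 2 (before symmetrisation):
`v (x_i) (x_i^T) = v (x_i) (x_i^F) = 1`, and `v c (x_i^T) = 1` when `x_i`
occurs positively in clause `c` and `v c (x_i^F) = 1` when `x_i` occurs
negatively in `c`. -/
def OneGame (n : ℕ) (cs : List Clause2) (a b : ℕ) : Prop :=
  (∃ i : ℕ, 1 ≤ i ∧ i ≤ n ∧ a = xPl n i ∧ (b = xTPl n i ∨ b = xFPl n i)) ∨
  (∃ j : ℕ, j < cs.length ∧ a = cPl n (j + 1) ∧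
      (b = litPl n (cs.getD j ((0, true), (0, true))).1 ∨
        b = litPl n (cs.getD j ((0, true), (0, true))).2))

/-- The explicitly zero-valued games of Construction 2 (before symmetrisation):
`v d_i (d̂_i) = v d_i (d̃_i) = v d_i (x_i) = 0`. -/
def ZeroGame (n a b : ℕ) : Prop :=
  ∃ i : ℕ, 1 ≤ i ∧ i ≤ n ∧ a = dMid n i ∧
    (b = dHat n i ∨ b = dTil n i ∨ b = xPl n i)

/-- `a` is one of the players `d_i` or `x_i` for some `i ∈ {1, …, n}`. -/
def DXPlayer (n a : ℕ) : Prop :=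
  ∃ i : ℕ, 1 ≤ i ∧ i ≤ n ∧ (a = dMid n i ∨ a = xPl n i)

open Classical in
/-- The (symmetric, round-oblivious) game-value function of Construction 2:
value `1` for the games described by `OneGame`; value `0` for the games
described by `ZeroGame`; value `-5` for every other game involving some `d_i`
or `x_i`; and value `0` for all remaining games. -/
noncomputable def gv2 (n : ℕ) (cs : List Clause2) (a b _r : ℕ) : ℤ :=
  if OneGame n cs a b ∨ OneGame n cs b a then 1
  else if ZeroGame n a b ∨ ZeroGame n b a then 0
  else if DXPlayer n a ∨ DXPlayer n b then -5
  else 0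


lemma winner_cons (a : ℕ) (l : List ℕ) : winner (a :: l) = max a (winner l) := rfl

lemma winner_append (l₁ l₂ : List ℕ) : winner (l₁ ++ l₂) = max (winner l₁) (winner l₂) := by
  induction l₁ with
  | nil => simp [winner]
  | cons a l ih =>
    simp only [winner, List.cons_append, List.foldr_cons] at ih ⊢
    rw [ih, max_assoc]

lemma winner_mem {l : List ℕ} (hl : l ≠ []) : winner l ∈ l := by
  induction l with
  | nil => exact absurd rfl hl
  | cons a l ih =>
    rcases eq_or_ne l [] with rfl | h
    · simp [winner]
    · rcases max_choice a (winner l) with hm | hm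
      · simp [winner_cons, hm]
      · rw [winner_cons, hm]
        exact List.mem_cons_of_mem _ (ih h)

lemma winner_cons_of_forall_le {a : ℕ} {l : List ℕ} (h : ∀ b ∈ l, b ≤ a) : winner (a :: l) = a := by
  rcases eq_or_ne l [] with rfl | hl
  · simp [winner]
  · exact max_eq_left (h _ (winner_mem hl))

/-- A tournament made of `2 ^ k` blocks of size `2 ^ b` has at least the total value of the blocks,
provided that games between block winners have nonnegative value. -/
lemma sum_tourValue_le_tourValue_flatten {v : ℕ → ℕ → ℕ → ℤ} {P : ℕ → Prop}
    (hv : ∀ a c r, P a → P c → 0 ≤ v a c r) (b k : ℕ) (L : List (List ℕ))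
    (hL : L.length = 2 ^ k) (hlen : ∀ l ∈ L, l.length = 2 ^ b) (hP : ∀ l ∈ L, P (winner l)) :
    P (winner L.flatten) ∧ (L.map (tourValue v b)).sum ≤ tourValue v (b + k) L.flatten := by
  induction k generalizing L with
  | zero =>
    obtain ⟨l, rfl⟩ := List.length_eq_one_iff.mp (by simpa using hL)
    simpa using hP
  | succ k ih =>
    obtain ⟨L₁, L₂, rfl, h₁, h₂⟩ : ∃ L₁ L₂, L = L₁ ++ L₂ ∧ L₁.length = 2 ^ k ∧ L₂.length = 2 ^ k :=
      ⟨L.take (2 ^ k), L.drop (2 ^ k), (List.take_append_drop _ _).symm,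
        by rw [List.length_take, hL, pow_succ]; omega,
        by rw [List.length_drop, hL, pow_succ]; omega⟩
    simp only [List.mem_append] at hlen hP
    obtain ⟨p₁, s₁⟩ := ih L₁ h₁ (fun l h => hlen l (.inl h)) (fun l h => hP l (.inl h))
    obtain ⟨p₂, s₂⟩ := ih L₂ h₂ (fun l h => hlen l (.inr h)) (fun l h => hP l (.inr h))
    have hfl : L₁.flatten.length = 2 ^ (b + k) := by
      rw [List.length_flatten, List.map_congr_left (g := fun _ => 2 ^ b)
        (fun l h => hlen l (.inl h))]
      simp [h₁, pow_add, mul_comm]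
    constructor
    · rw [List.flatten_append, winner_append]
      rcases max_choice (winner L₁.flatten) (winner L₂.flatten) with h | h <;> rw [h] <;> assumption
    · rw [← add_assoc, tourValue, List.flatten_append, List.take_left' hfl, List.drop_left' hfl,
        List.map_append, List.sum_append]
      linarith [hv _ _ (b + k + 1) p₁ p₂]

lemma tourValue_nonneg {v : ℕ → ℕ → ℕ → ℤ} {P : ℕ → Prop}
    (hv : ∀ a c r, P a → P c → 0 ≤ v a c r) (k : ℕ) (l : List ℕ)
    (hl : l.length = 2 ^ k) (hP : ∀ a ∈ l, P a) : 0 ≤ tourValue v k l := by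
  have h := (sum_tourValue_le_tourValue_flatten hv 0 k (l.map fun a => [a]) (by simpa using hl)
    (by simp) (by simpa [winner] using hP)).2
  rw [← List.flatMap_def, List.flatMap_singleton'] at h
  simpa [Function.comp_def, tourValue] using h

lemma isSeeding_of_subset {N : Finset ℕ} {l : List ℕ} (hl : l.length ≤ N.card)
    (h : N ⊆ l.toFinset) : IsSeeding N l := by
  have heq : l.toFinset = N :=
    (Finset.eq_of_subset_of_card_le h ((List.toFinset_card_le l).trans hl)).symm
  refine ⟨?_, heq⟩
  rw [← List.dedup_eq_self]
  refine (List.dedup_sublist l).eq_of_length_le ?_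
  rw [← List.card_toFinset, heq]
  exact hl

/-- If `f` has fibres of size at most `a ≤ b`, its domain can be placed injectively in `β × Fin b`,
each element over its image and within the first `a` columns; a bijection then lists the rest. -/
lemma exists_equiv_sum_of_card_fiber_le {m n a b : ℕ} (hab : a ≤ b) (f : Fin m → Fin n)
    (hf : ∀ i, Fintype.card {j // f j = i} ≤ a) :
    ∃ e : Fin n × Fin b ≃ Fin m ⊕ Fin (n * b - m),
      m ≤ n * a ∧ ∀ j, (e.symm (.inl j)).1 = f j ∧ ((e.symm (.inl j)).2 : ℕ) < a := by
  let g : ∀ i, {j // f j = i} ↪ Fin a := fun i =>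
    (Function.Embedding.nonempty_of_card_le (by simpa using hf i)).some
  have hg' : Function.Injective fun j => (f j, g (f j) ⟨j, rfl⟩) := by
    intro j j' hj
    simp only [Prod.mk.injEq] at hj
    obtain ⟨h₁, h₂⟩ := hj
    have key : ∀ i (hj : f j = i), g i ⟨j, hj⟩ = g (f j') ⟨j', rfl⟩ → i = f j' → j = j' := by
      rintro i hj h rfl
      simpa using (g _).injective h
    exact key _ rfl h₂ h₁
  have hm : m ≤ n * a := by simpa using Fintype.card_le_of_injective _ hg'
  let p : Fin m → Fin n × Fin b := fun j => (f j, Fin.castLE hab (g (f j) ⟨j, rfl⟩))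
  have hp : Function.Injective p := by
    intro j j' hj
    simp only [p, Prod.mk.injEq, Fin.castLE_inj] at hj
    exact hg' (by simpa using hj)
  have hc : Nonempty (↑(Set.range p)ᶜ ≃ Fin (n * b - m)) := by
    classical
    refine Fintype.card_eq.mp ?_
    rw [Fintype.card_compl_set, Set.card_range_of_injective hp]
    simp
  classical
  refine ⟨(Equiv.Set.sumCompl (Set.range p)).symm.trans
    (Equiv.sumCongr (Equiv.ofInjective p hp).symm hc.some), hm, fun j => ?_⟩
  simp [p]

lemma sum_fin_eq_countP {β : Type*} (l : List β) (p : β → Bool) :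
    ∑ j : Fin l.length, (if p l[j] then 1 else 0) = l.countP p := by
  refine (Fin.sum_univ_fun_getElem l (fun c => if p c then 1 else 0)).trans ?_
  induction l with
  | nil => simp
  | cons a l ih => simp [List.countP_cons, ih, add_comm]

lemma countP_mem_le_countP_lits (cs : List Clause2) (x : ℕ) :
    cs.countP (fun c => c.1.1 == x || c.2.1 == x) ≤ (lits cs).countP (fun p => p.1 == x) := by
  induction cs with
  | nil => simp
  | cons c cs ih =>
    have : lits (c :: cs) = c.1 :: c.2 :: lits cs := rfl
    rw [this]
    simp only [List.countP_cons, Bool.or_eq_true]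
    split_ifs <;> first | omega | simp_all

lemma gv2_nonneg_of_not_dxPlayer {n : ℕ} {cs : List Clause2} {a b : ℕ} (r : ℕ)
    (ha : ¬ DXPlayer n a) (hb : ¬ DXPlayer n b) : 0 ≤ gv2 n cs a b r := by
  unfold gv2
  split_ifs <;> first | omega | tauto

lemma gv2_nonneg_of_zeroGame {n : ℕ} {cs : List Clause2} {a b : ℕ} (r : ℕ)
    (h : ZeroGame n a b ∨ ZeroGame n b a) : 0 ≤ gv2 n cs a b r := by
  unfold gv2
  split_ifs <;> omega

lemma gv2_of_oneGame {n : ℕ} {cs : List Clause2} {a b : ℕ} (r : ℕ)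
    (h : OneGame n cs a b ∨ OneGame n cs b a) : gv2 n cs a b r = 1 := if_pos h

lemma sixteen_mul_le_numP (n : ℕ) : 16 * n ≤ numP n := Nat.le_pow_clog (by norm_num) _

lemma not_dxPlayer_of_lt {n a : ℕ} (h : a < numP n - 6 * n) : ¬ DXPlayer n a := by
  rintro ⟨i, h₁, h₂, h | h⟩ <;>
    simp only [dMid, xPl] at h <;> omega

lemma not_dxPlayer_dHat {n i : ℕ} (h₁ : 1 ≤ i) (h₂ : i ≤ n) : ¬ DXPlayer n (dHat n i) := by
  have := sixteen_mul_le_numP n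
  rintro ⟨j, h₃, h₄, h | h⟩ <;>
    simp only [dMid, xPl, dHat] at h <;> omega

lemma not_dxPlayer_litPl {n i : ℕ} (h₁ : 1 ≤ i) (h₂ : i ≤ n) (b : Bool) :
    ¬ DXPlayer n (litPl n (i, b)) := by
  have := sixteen_mul_le_numP n
  cases b <;> rintro ⟨j, h₃, h₄, h | h⟩ <;>
    simp only [litPl, dMid, xPl, xTPl, xFPl, if_true, Bool.false_eq_true, if_false] at h <;> omega

lemma litPl_lt_xPl {n i : ℕ} (h₁ : 1 ≤ i) (h₂ : i ≤ n) (b : Bool) :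
    litPl n (i, b) < xPl n i := by
  have := sixteen_mul_le_numP n
  cases b <;> simp only [litPl, if_true, Bool.false_eq_true, if_false, xPl, xTPl, xFPl] <;> omega

lemma le_litPl {n i : ℕ} (h₁ : 1 ≤ i) (h₂ : i ≤ n) (b : Bool) :
    numP n - 6 * n ≤ litPl n (i, b) := by
  cases b <;> simp only [litPl, if_true, Bool.false_eq_true, if_false, xTPl, xFPl] <;> omega

/-- The block of sixteen seed positions for the variable `x_i` with truth value `b`: the literal
player of `x_i` that is made true meets the fillers `s 0`, `s 1`, `s 2` (or stronger fillers). -/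
def varBlock (n i : ℕ) (b : Bool) (s : Fin 10 → ℕ) : List ℕ :=
  [dHat n i, s 3, s 4, s 5, dMid n i, dTil n i, xPl n i, litPl n (i, !b),
    litPl n (i, b), s 0, s 1, s 6, s 2, s 7, s 8, s 9]

lemma winner_varBlock {n i : ℕ} (h₁ : 1 ≤ i) (h₂ : i ≤ n) (b : Bool) {s : Fin 10 → ℕ}
    (hs : ∀ t, s t < numP n - 6 * n) :
    winner (varBlock n i b s) = dHat n i := by
  have hN := sixteen_mul_le_numP n
  refine winner_cons_of_forall_le fun a ha => ?_
  have hd : dMid n i ≤ dHat n i ∧ dTil n i ≤ dHat n i ∧ xPl n i ≤ dHat n i ∧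
      numP n - 6 * n ≤ dHat n i := by
    unfold dTil dMid dHat xPl; omega
  have hl := litPl_lt_xPl h₁ h₂
  have hs' : ∀ t, s t ≤ dHat n i := fun t => (hs t).le.trans hd.2.2.2
  have hl' : ∀ b, litPl n (i, b) ≤ dHat n i := fun b => (hl b).le.trans hd.2.2.1
  simp only [List.mem_cons, List.not_mem_nil, or_false] at ha
  rcases ha with rfl | rfl | rfl | rfl | rfl | rfl | rfl | rfl | rfl | rfl | rfl | rfl | rfl | rfl |
    rfl <;> first | exact hs' _ | exact hl' _ | omega

lemma le_tourValue_varBlock {n i : ℕ} (h₁ : 1 ≤ i) (h₂ : i ≤ n) (b : Bool) {s : Fin 10 → ℕ}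
    (hs : ∀ t, s t < numP n - 6 * n)
    (cs : List Clause2) :
    1 + gv2 n cs (litPl n (i, b)) (s 0) 0 + gv2 n cs (litPl n (i, b)) (max (s 1) (s 6)) 0 +
      gv2 n cs (litPl n (i, b)) (max (max (s 2) (s 7)) (max (s 8) (s 9))) 0 ≤
    tourValue (gv2 n cs) 4 (varBlock n i b s) := by
  have hN := sixteen_mul_le_numP n
  have s0 := hs 0; have s1 := hs 1; have s2 := hs 2; have s3 := hs 3; have s4 := hs 4
  have s5 := hs 5; have s6 := hs 6; have s7 := hs 7; have s8 := hs 8; have s9 := hs 9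
  have hl := le_litPl h₁ h₂ b
  have hx := litPl_lt_xPl h₁ h₂ b
  have hx' := litPl_lt_xPl h₁ h₂ (!b)
  have hd : dTil n i < dMid n i ∧ dMid n i < dHat n i ∧ xPl n i < dTil n i := by
    unfold dTil dMid dHat xPl; omega
  have hw : ∀ a c, ¬ DXPlayer n a → ¬ DXPlayer n c → ∀ r, 0 ≤ gv2 n cs a c r :=
    fun a c ha hc r => gv2_nonneg_of_not_dxPlayer r ha hc
  have hf : ∀ {a}, a < numP n - 6 * n → ¬ DXPlayer n a := not_dxPlayer_of_lt
  have hH := not_dxPlayer_dHat h₁ h₂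
  have g₁ := hw _ _ hH (hf s3) 1
  have g₂ := hw _ _ (hf s4) (hf s5) 1
  have g₃ : 0 ≤ gv2 n cs (dMid n i) (dTil n i) 1 :=
    gv2_nonneg_of_zeroGame _ (.inl ⟨i, h₁, h₂, rfl, .inr (.inl rfl)⟩)
  have g₄ : gv2 n cs (xPl n i) (litPl n (i, !b)) 1 = 1 :=
    gv2_of_oneGame _ (.inl (.inl ⟨i, h₁, h₂, rfl, by cases b <;> simp [litPl]⟩))
  have g₅ := hw _ _ (hf s1) (hf s6) 1
  have g₆ := hw _ _ (hf s2) (hf s7) 1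
  have g₇ := hw _ _ (hf s8) (hf s9) 1
  have g₈ := hw _ _ hH (hf (max_lt s4 s5)) 2
  have g₉ : 0 ≤ gv2 n cs (dMid n i) (xPl n i) 2 :=
    gv2_nonneg_of_zeroGame _ (.inl ⟨i, h₁, h₂, rfl, .inr (.inr rfl)⟩)
  have g₁₀ := hw _ _ (hf (max_lt s2 s7)) (hf (max_lt s8 s9)) 2
  have g₁₁ : 0 ≤ gv2 n cs (dHat n i) (dMid n i) 3 :=
    gv2_nonneg_of_zeroGame _ (.inr ⟨i, h₁, h₂, rfl, .inl rfl⟩)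
  have g₁₂ := hw _ _ hH (not_dxPlayer_litPl h₁ h₂ b) 4
  have m₁ : max (dHat n i) (s 3) = dHat n i := by omega
  have m₂ : max (dMid n i) (dTil n i) = dMid n i := by omega
  have m₃ : max (xPl n i) (litPl n (i, !b)) = xPl n i := by omega
  have m₄ : max (litPl n (i, b)) (s 0) = litPl n (i, b) := by omega
  have m₅ : max (dHat n i) (max (s 3) (max (s 4) (s 5))) = dHat n i := by omega
  have m₆ : max (dMid n i) (max (dTil n i) (xPl n i)) = dMid n i := by omega
  have m₇ : max (litPl n (i, b)) (max (s 0) (max (s 1) (s 6))) = litPl n (i, b) := by omega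
  have m₈ : max (dHat n i) (max (s 3) (max (s 4) (max (s 5) (dMid n i)))) = dHat n i := by omega
  have m₉ : max (litPl n (i, b)) (max (s 0) (max (s 1) (max (s 6) (max (s 2) (max (s 7)
      (max (s 8) (s 9))))))) = litPl n (i, b) := by omega
  have m₁₀ : max (max (s 2) (s 7)) (max (s 8) (s 9)) = max (s 2) (max (s 7) (max (s 8) (s 9))) := by
    omega
  rw [m₁₀]
  simp only [varBlock, tourValue, winner, Nat.reducePow, List.take_succ_cons, List.take_zero,
    List.drop_succ_cons, List.drop_zero, List.foldr_cons, List.foldr_nil, Nat.max_zero, zero_add,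
    add_zero, Nat.reduceAdd, m₁, m₂, m₃, m₄, m₅, m₆, m₇, m₈, m₉]
  have r₁ : ∀ a c r, gv2 n cs a c r = gv2 n cs a c 0 := fun _ _ _ => rfl
  simp only [r₁ _ _ 1, r₁ _ _ 2, r₁ _ _ 3, r₁ _ _ 4] at *
  linarith

lemma mem_varBlock (n i : ℕ) (b : Bool) (s : Fin 10 → ℕ) (t : Fin 10) : s t ∈ varBlock n i b s := by
  fin_cases t <;> simp [varBlock]

lemma litPl_mem_varBlock (n i : ℕ) (b c : Bool) (s : Fin 10 → ℕ) :
    litPl n (i, c) ∈ varBlock n i b s := by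
  cases b <;> cases c <;> simp [varBlock]

/-- Player `j` of the clauses and player `t` of the dummies. -/
def fillerPl (n m : ℕ) : Fin m ⊕ Fin (n * 10 - m) → ℕ :=
  Sum.elim (fun j => cPl n (j + 1)) (fun t => t)

lemma fillerPl_lt {n m : ℕ} (hn : 0 < n) (u : Fin m ⊕ Fin (n * 10 - m)) :
    fillerPl n m u < numP n - 6 * n := by
  have := sixteen_mul_le_numP n
  rcases u with j | t
  · simp only [fillerPl, Sum.elim_inl, cPl]; omega
  · simp only [fillerPl, Sum.elim_inr]; omega

lemma fillerPl_inr_lt_inl {n m : ℕ} (j : Fin m) (t : Fin (n * 10 - m)) :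
    fillerPl n m (.inr t) < fillerPl n m (.inl j) := by
  have := sixteen_mul_le_numP n
  simp only [fillerPl, Sum.elim_inl, Sum.elim_inr, cPl]; omega

/-- The variable to which a clause is assigned: one that makes it true, if there is one. -/
def satVar (α : ℕ → Bool) (c : Clause2) : ℕ := if α c.1.1 == c.1.2 then c.1.1 else c.2.1

lemma litPl_satVar {α : ℕ → Bool} {c : Clause2} (n : ℕ) (h : clauseSat α c) :
    litPl n (satVar α c, α (satVar α c)) = litPl n c.1 ∨
      litPl n (satVar α c, α (satVar α c)) = litPl n c.2 := by
  obtain ⟨⟨x, b⟩, ⟨y, d⟩⟩ := c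
  by_cases hx : α x = b
  · left; simp [satVar, hx]
  · right
    have hy : α y = d := by simpa [clauseSat, hx] using h
    simp [satVar, hx, hy]

lemma card_satVar_le {n : ℕ} {cs : List Clause2} (hgood : Good23 n cs) (α : ℕ → Bool) {x : ℕ}
    (h₁ : 1 ≤ x) (h₂ : x ≤ n) :
    Fintype.card {j : Fin cs.length // satVar α cs[j] = x} ≤ 3 := by
  rw [Fintype.card_subtype, Finset.card_filter]
  have h := sum_fin_eq_countP cs (fun c => satVar α c == x)
  simp only [beq_iff_eq] at h
  rw [h]
  refine le_trans (le_trans (List.countP_mono_left ?_) (countP_mem_le_countP_lits cs x))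
    (hgood.2 x h₁ h₂).2
  intro c _ hc
  simp only [satVar, beq_iff_eq] at hc
  split_ifs at hc <;> simp [hc]

lemma satVar_mem_Icc {n : ℕ} {cs : List Clause2} (hgood : Good23 n cs) (α : ℕ → Bool)
    {c : Clause2} (hc : c ∈ cs) : 1 ≤ satVar α c ∧ satVar α c ≤ n := by
  have := hgood.1 c hc
  unfold satVar
  split_ifs <;> omega

/-- If the (2,3)-CNF formula `φ` admits an assignment
satisfying at least `k` clauses, then the Construction 2 instance `T_φ` admits
a seeding of tournament value at least `k + n`. -/
theorem stmt_8 (n k : ℕ) (cs : List Clause2) (hgood : Good23 n cs)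
    (α : ℕ → Bool) (hk : k ≤ satCount α cs) :
    ∃ l : List ℕ, IsSeeding (Finset.range (numP n)) l ∧
      ((k : ℤ) + n) ≤ tourValue (gv2 n cs) (Nat.clog 2 (16 * n)) l := by
  rcases Nat.eq_zero_or_pos n with rfl | hn
  · have hcs : cs = [] := List.eq_nil_iff_forall_not_mem.mpr fun c hc => by
      have := hgood.1 c hc
      omega
    subst hcs
    have hk0 : k = 0 := by simpa [satCount] using hk
    subst hk0
    exact ⟨[0], by simp [IsSeeding, numP], by simp [tourValue]⟩
  have hN := sixteen_mul_le_numP n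
  obtain ⟨r, hr⟩ : ∃ r, Nat.clog 2 (16 * n) = 4 + r := by
    refine Nat.exists_eq_add_of_le (not_lt.mp fun h => ?_)
    have : numP n ≤ 2 ^ 3 := Nat.pow_le_pow_right (by norm_num) (Nat.le_of_lt_succ h)
    omega
  have hNr : numP n = 16 * 2 ^ r := by rw [numP, hr, pow_add]; norm_num
  set m := cs.length with hm
  let f : Fin m → Fin n := fun j => ⟨satVar α cs[j] - 1, by
    have := satVar_mem_Icc hgood α (List.getElem_mem j.2)
    simp only [Fin.getElem_fin]
    omega⟩
  have hf : ∀ j, ((f j : ℕ) + 1) = satVar α cs[j] := fun j => by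
    have := satVar_mem_Icc hgood α (List.getElem_mem j.2)
    simp only [f, Fin.getElem_fin]
    omega
  obtain ⟨e, hmn, he⟩ := exists_equiv_sum_of_card_fiber_le (a := 3) (b := 10) (by norm_num) f fun i => by
    refine le_trans (Fintype.card_subtype_mono _ _ ?_)
      (card_satVar_le hgood α (x := i + 1) (by omega) (by omega))
    rintro j rfl
    exact (hf j).symm
  let s : Fin n → Fin 10 → ℕ := fun i t => fillerPl n m (e (i, t))
  have hs : ∀ i t, s i t < numP n - 6 * n := fun i t => fillerPl_lt hn _
  let V : Fin n → List ℕ := fun i => varBlock n (i + 1) (α (i + 1)) (s i)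
  let D : Fin (2 ^ r - n) → List ℕ := fun i =>
    List.ofFn fun t : Fin 16 => n * 10 - m + 16 * i + t
  let g : Fin m ⊕ Fin (n * 10 - m) → ℤ := Sum.elim (fun j => if clauseSat α cs[j] then 1 else 0) 0
  have hdum : ∀ i, ∀ a ∈ D i, ¬ DXPlayer n a := by
    intro i a ha
    obtain ⟨t, rfl⟩ := (List.mem_ofFn' _ _).mp ha
    refine not_dxPlayer_of_lt ?_
    dsimp only
    omega
  have hclause : ∀ (i : Fin n) (t : Fin 10) (w : ℕ), ¬ DXPlayer n w →
      (∀ j, e (i, t) = .inl j → w = s i t) →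
      g (e (i, t)) ≤ gv2 n cs (litPl n (i + 1, α (i + 1))) w 0 := by
    intro i t w hw hws
    have h0 : 0 ≤ gv2 n cs (litPl n (i + 1, α (i + 1))) w 0 :=
      gv2_nonneg_of_not_dxPlayer _ (not_dxPlayer_litPl (by omega) (by omega) _) hw
    rcases hj : e (i, t) with j | t'
    · simp only [g, Sum.elim_inl]
      split_ifs with hsat
      · refine (gv2_of_oneGame 0 (.inr (.inr ⟨j, j.2, ?_, ?_⟩))).ge
        · rw [hws j hj]
          simp [s, hj, fillerPl]
        · have hi : (i : ℕ) + 1 = satVar α cs[j] := by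
            rw [← hf, ← (he j).1, ← hj]
            simp
          rw [hi, List.getD_eq_getElem _ _ j.2]
          exact litPl_satVar n hsat
      · exact h0
    · simpa [g] using h0
  have hdummy : ∀ (i : Fin n) (t : Fin 10), 3 ≤ (t : ℕ) → ∃ t', e (i, t) = .inr t' := by
    intro i t ht
    rcases hj : e (i, t) with j | t'
    · have := (he j).2
      rw [← hj] at this
      simp only [Equiv.symm_apply_apply] at this
      omega
    · exact ⟨t', rfl⟩
  have hmax : ∀ (i : Fin n) (t u : Fin 10) (j : Fin m), 3 ≤ (u : ℕ) → e (i, t) = .inl j →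
      s i u < s i t := by
    intro i t u j hu hj
    obtain ⟨t', ht'⟩ := hdummy i u hu
    simp only [s, hj, ht']
    exact fillerPl_inr_lt_inl j t'
  have hV : ∀ i, 1 + ∑ t, g (e (i, t)) ≤ tourValue (gv2 n cs) 4 (V i) := by
    intro i
    refine le_trans ?_
      (le_tourValue_varBlock (by omega) (by omega) (α (i + 1)) (hs i) cs)
    have hg : ∀ t : Fin 10, 3 ≤ (t : ℕ) → g (e (i, t)) = 0 := fun t ht => by
      obtain ⟨t', ht'⟩ := hdummy i t ht
      simp [g, ht']
    have hsum : ∑ t, g (e (i, t)) = g (e (i, 0)) + g (e (i, 1)) + g (e (i, 2)) := by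
      have h3 : ∀ t : Fin 10, t ∉ ({0, 1, 2} : Finset (Fin 10)) → 3 ≤ (t : ℕ) := by decide
      rw [← Finset.sum_subset (Finset.subset_univ {0, 1, 2}) fun t _ ht => hg t (h3 t ht)]
      simp [add_assoc]
    have c₀ := hclause i 0 (s i 0) (not_dxPlayer_of_lt (hs i 0)) fun _ _ => rfl
    have c₁ := hclause i 1 (max (s i 1) (s i 6))
      (not_dxPlayer_of_lt (max_lt (hs i 1) (hs i 6)))
      fun j hj => max_eq_left (hmax i 1 6 j (by simp) hj).le
    have c₂ := hclause i 2 (max (max (s i 2) (s i 7)) (max (s i 8) (s i 9)))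
      (not_dxPlayer_of_lt (max_lt (max_lt (hs i 2) (hs i 7)) (max_lt (hs i 8) (hs i 9))))
      fun j hj => by
        have h₇ := hmax i 2 7 j (by simp) hj
        have h₈ := hmax i 2 8 j (by simp) hj
        have h₉ := hmax i 2 9 j (by simp) hj
        omega
    linarith
  have hlen : ∀ l ∈ List.ofFn V ++ List.ofFn D, l.length = 2 ^ 4 := by
    intro l hl
    rcases List.mem_append.mp hl with h | h <;> obtain ⟨i, rfl⟩ := (List.mem_ofFn' _ _).mp h
    · rfl
    · simp [D]
  have hL : (List.ofFn V ++ List.ofFn D).length = 2 ^ r := by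
    rw [List.length_append, List.length_ofFn, List.length_ofFn]
    omega
  refine ⟨(List.ofFn V ++ List.ofFn D).flatten, isSeeding_of_subset ?_ ?_, ?_⟩
  · rw [List.length_flatten, List.map_congr_left (g := fun _ => 2 ^ 4) hlen, List.map_const',
      List.sum_replicate, hL, Finset.card_range, hNr]
    simp [mul_comm]
  · intro a ha
    rw [Finset.mem_range] at ha
    have memV : ∀ i (hi : i < n), a ∈ varBlock n (i + 1) (α (i + 1)) (s ⟨i, hi⟩) →
        a ∈ (List.ofFn V ++ List.ofFn D).flatten.toFinset := by
      intro i hi h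
      rw [List.mem_toFinset, List.mem_flatten]
      exact ⟨_, List.mem_append_left _ ((List.mem_ofFn' _ _).mpr ⟨⟨i, hi⟩, rfl⟩), h⟩
    have memE : ∀ u, a = fillerPl n m u → a ∈ (List.ofFn V ++ List.ofFn D).flatten.toFinset := by
      intro u hu
      refine memV (e.symm u).1 (e.symm u).1.2 ?_
      have : a = s (e.symm u).1 (e.symm u).2 := by simp [s, hu]
      rw [this]
      exact mem_varBlock _ _ _ _ _
    by_cases h₁ : numP n - a ≤ 3 * n
    · refine memV ((numP n - a - 1) / 3) (by omega) ?_
      have : a = dHat n ((numP n - a - 1) / 3 + 1) ∨ a = dMid n ((numP n - a - 1) / 3 + 1) ∨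
          a = dTil n ((numP n - a - 1) / 3 + 1) := by
        unfold dHat dMid dTil; omega
      rcases this with h | h | h <;> simp [varBlock, ← h]
    by_cases h₂ : numP n - a ≤ 6 * n
    · obtain ⟨i, hi, h⟩ : ∃ i < n, a = xPl n (i + 1) ∨ a = litPl n (i + 1, true) ∨
          a = litPl n (i + 1, false) := by
        refine ⟨(numP n - a - 3 * n - 1) / 3, by omega, ?_⟩
        simp only [litPl, if_true, Bool.false_eq_true, if_false, xPl, xTPl, xFPl]
        omega
      refine memV i hi ?_
      rcases h with h | h | h
      · simp [varBlock, ← h]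
      · exact h ▸ litPl_mem_varBlock _ _ _ _ _
      · exact h ▸ litPl_mem_varBlock _ _ _ _ _
    by_cases h₃ : numP n - a ≤ 6 * n + m
    · refine memE (.inl ⟨numP n - a - 6 * n - 1, by omega⟩) ?_
      simp only [fillerPl, Sum.elim_inl, cPl]
      omega
    by_cases h₄ : a < n * 10 - m
    · exact memE (.inr ⟨a, h₄⟩) rfl
    · rw [List.mem_toFinset, List.mem_flatten]
      refine ⟨_, List.mem_append_right _ ((List.mem_ofFn' _ _).mpr
        ⟨⟨(a - (n * 10 - m)) / 16, by omega⟩, rfl⟩), (List.mem_ofFn' _ _).mpr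
        ⟨⟨(a - (n * 10 - m)) % 16, by omega⟩, ?_⟩⟩
      simp only
      omega
  · rw [hr]
    refine le_trans ?_ (sum_tourValue_le_tourValue_flatten (v := gv2 n cs)
      (fun a c r => gv2_nonneg_of_not_dxPlayer r) 4 r _ hL hlen ?_).2
    · rw [List.map_append, List.sum_append, List.map_ofFn, List.map_ofFn, List.sum_ofFn,
        List.sum_ofFn]
      have hD : 0 ≤ ∑ i, (tourValue (gv2 n cs) 4 ∘ D) i := Finset.sum_nonneg fun i _ =>
        tourValue_nonneg (fun a c r => gv2_nonneg_of_not_dxPlayer r) 4 _ (by simp [D]) (hdum i)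
      have hsum : ∑ i, ∑ t, g (e (i, t)) = (satCount α cs : ℤ) := by
        rw [← Fintype.sum_prod_type' (fun i t => g (e (i, t))), Equiv.sum_comp e g,
          Fintype.sum_sum_type, satCount, ← sum_fin_eq_countP]
        simp only [g, Sum.elim_inl, Sum.elim_inr, Pi.zero_apply, Finset.sum_const_zero, add_zero,
          Nat.cast_sum, Nat.cast_ite, Nat.cast_one, Nat.cast_zero]
        rfl
      have hVs := Finset.sum_le_sum fun i (_ : i ∈ Finset.univ) => hV i
      rw [Finset.sum_add_distrib, hsum] at hVs
      simp only [Finset.sum_const, Finset.card_univ, Fintype.card_fin, nsmul_eq_mul, mul_one] at hVs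
      simp only [Function.comp_apply] at hD ⊢
      have : (k : ℤ) ≤ satCount α cs := by exact_mod_cast hk
      linarith
    · intro l hl
      rcases List.mem_append.mp hl with h | h <;> obtain ⟨i, rfl⟩ := (List.mem_ofFn' _ _).mp h
      · rw [winner_varBlock (by omega) (by omega) _ (hs i)]
        exact not_dxPlayer_dHat (by omega) (by omega)
      · exact hdum i _ (winner_mem (by simp [D]))
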